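/- Safety of paths avoiding the regeneration transition: let (TN,μ) be a perpetual T-system with regeneration cluster cl and let t_cl be the unique transition of cl. Then every elementary path δ of TN that does not contain t_cl has token count ‖μ‖_δ ≤ 1. -/

import Mathlib

open Classical

/-- A (finite, bipartite) Petri *net*: disjoint finite sets of places and
transitions, and an edge relation running only between places and transitions. -/
structure Net (α : Type*) where
  places : Finset α
  transitions : Finset α
  F : α → α → Prop
  disj : Disjoint places transitions
  edges : ∀ x y, F x y →
    (x ∈ places ∧ y ∈ transitions) ∨ (x ∈ transitions ∧ y ∈ places)

namespace Net

variable {α : Type*} [DecidableEq α]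

/-- The nodes of a net. -/
def nodes (N : Net α) : Finset α := N.places ∪ N.transitions

/-- Pre-set of a node. -/
def pre (N : Net α) (x : α) : Set α := {y | N.F y x}

/-- Post-set of a node. -/
def post (N : Net α) (x : α) : Set α := {y | N.F x y}

/-- A transition `t` is enabled at a marking `μ` if every pre-place is marked. -/
def Enabled (N : Net α) (μ : α → ℕ) (t : α) : Prop :=
  t ∈ N.transitions ∧ ∀ p, N.F p t → 1 ≤ μ p

/-- Firing a transition: remove one token from each pre-place,
add one token at each post-place. -/
noncomputable def fire (N : Net α) (t : α) (μ : α → ℕ) : α → ℕ :=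
  fun p => μ p - (if N.F p t then 1 else 0) + (if N.F t p then 1 else 0)

/-- `FireSeq N μ σ ν`: the occurrence sequence `σ` is enabled at `μ` and
firing it successively leads from `μ` to `ν`. -/
inductive FireSeq (N : Net α) : (α → ℕ) → List α → (α → ℕ) → Prop
  | nil (μ : α → ℕ) : FireSeq N μ [] μ
  | cons {μ ν : α → ℕ} {t : α} {σ : List α} :
      N.Enabled μ t → FireSeq N (N.fire t μ) σ ν → FireSeq N μ (t :: σ) ν

/-- Reachability of markings. -/
def Reach (N : Net α) (μ ν : α → ℕ) : Prop := ∃ σ : List α, N.FireSeq μ σ ν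

/-- The set of transitions enabled at `μ`. -/
def en (N : Net α) (μ : α → ℕ) : Set α := {t | N.Enabled μ t}

/-- Equality of markings (as maps on the places of the net). -/
def MarkingEq (N : Net α) (μ ν : α → ℕ) : Prop := ∀ p ∈ N.places, μ p = ν p

/-- Liveness of a Petri net `(N, μ₀)`. -/
def Live (N : Net α) (μ₀ : α → ℕ) : Prop :=
  ∀ t ∈ N.transitions, ∀ μ, N.Reach μ₀ μ → ∃ ν, N.Reach μ ν ∧ N.Enabled ν t

/-- Boundedness of a Petri net `(N, μ₀)`. -/
def Bounded (N : Net α) (μ₀ : α → ℕ) : Prop :=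
  ∃ K : ℕ, ∀ μ, N.Reach μ₀ μ → ∀ p ∈ N.places, μ p ≤ K

/-- A net is well-formed if it carries a live and bounded marking. -/
def WellFormed (N : Net α) : Prop := ∃ μ₀ : α → ℕ, N.Live μ₀ ∧ N.Bounded μ₀

/-- Free-choice net: `(p,t) ∈ F` implies `•t × p• ⊆ F`. -/
def FreeChoice (N : Net α) : Prop :=
  ∀ p ∈ N.places, ∀ t, N.F p t → ∀ p', N.F p' t → ∀ t', N.F p t' → N.F p' t'

/-- T-net: every place has exactly one pre-transition and one post-transition. -/
def IsTNet (N : Net α) : Prop :=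
  ∀ p ∈ N.places, (∃! t, N.F t p) ∧ (∃! t, N.F p t)

/-- A set of nodes is cluster-closed if with each place it contains the
post-set of the place and with each transition the pre-set of the transition. -/
def ClusterClosed (N : Net α) (S : Set α) : Prop :=
  (∀ p ∈ S, p ∈ N.places → ∀ t, N.F p t → t ∈ S) ∧
  (∀ t ∈ S, t ∈ N.transitions → ∀ p, N.F p t → p ∈ S)

/-- The cluster of a node: the smallest cluster-closed set of nodes containing it. -/
def clusterOf (N : Net α) (x : α) : Set α :=
  ⋂₀ {S : Set α | x ∈ S ∧ N.ClusterClosed S}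

/-- `cl` is a cluster of `N` if it is the cluster of some node. -/
def IsCluster (N : Net α) (cl : Set α) : Prop :=
  ∃ x ∈ N.nodes, cl = N.clusterOf x

/-- The marking `μ_cl` marking exactly the places of the cluster `cl`, once. -/
noncomputable def clusterMarking (N : Net α) (cl : Set α) : α → ℕ :=
  fun p => if p ∈ cl ∧ p ∈ N.places then 1 else 0

/-- `μh` is a home marking of `(N, μ₀)`: reachable from every reachable marking. -/
def IsHomeMarking (N : Net α) (μ₀ μh : α → ℕ) : Prop :=
  ∀ μ, N.Reach μ₀ μ → ∃ ν, N.Reach μ ν ∧ N.MarkingEq ν μh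

/-- `(N, μ₀)` is perpetual with regeneration cluster `cl`: live, bounded, and
`μ_cl` is a home marking for the cluster `cl`. -/
def Perpetual (N : Net α) (μ₀ : α → ℕ) (cl : Set α) : Prop :=
  N.Live μ₀ ∧ N.Bounded μ₀ ∧ N.IsCluster cl ∧
    N.IsHomeMarking μ₀ (N.clusterMarking cl)

/-- Lucency: enabling-equivalent reachable markings are equal. -/
def Lucent (N : Net α) (μ₀ : α → ℕ) : Prop :=
  ∀ μ₁ μ₂, N.Reach μ₀ μ₁ → N.Reach μ₀ μ₂ → N.en μ₁ = N.en μ₂ → N.MarkingEq μ₁ μ₂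

/-- A path of the net: a nonempty sequence of nodes along edges. -/
def IsPath (N : Net α) (δ : List α) : Prop :=
  δ ≠ [] ∧ (∀ x ∈ δ, x ∈ N.nodes) ∧ δ.Chain' N.F

/-- A circuit: a path whose last node is connected back to its first node. -/
def IsCircuit (N : Net α) (δ : List α) : Prop :=
  N.IsPath δ ∧ ∃ h : δ ≠ [], N.F (δ.getLast h) (δ.head h)

/-- Token count of a set of nodes: total number of tokens on its places. -/
def tokenCount (N : Net α) (μ : α → ℕ) (X : Finset α) : ℕ :=
  ∑ p ∈ X ∩ N.places, μ p

/-- The set `S` of nodes is strongly connected (in the induced subnet). -/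
def StronglyConnectedOn (N : Net α) (S : Finset α) : Prop :=
  ∀ x ∈ S, ∀ y ∈ S,
    Relation.ReflTransGen (fun a b => a ∈ S ∧ b ∈ S ∧ N.F a b) x y

/-- The set `S` of nodes is weakly connected (in the induced subnet). -/
def WeaklyConnectedOn (N : Net α) (S : Finset α) : Prop :=
  ∀ x ∈ S, ∀ y ∈ S,
    Relation.ReflTransGen (fun a b => a ∈ S ∧ b ∈ S ∧ (N.F a b ∨ N.F b a)) x y

/-- The (full) subnet spanned by `S` is transition-bordered: every place of `S`
has all its neighbours inside `S`. -/
def TransitionBordered (N : Net α) (S : Finset α) : Prop :=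
  ∀ p ∈ S, p ∈ N.places → ∀ y, (N.F y p ∨ N.F p y) → y ∈ S

/-- The full subnet spanned by `S` is a T-net: each place of `S` has exactly one
pre-transition and one post-transition inside `S`. -/
def TNetOn (N : Net α) (S : Finset α) : Prop :=
  ∀ p ∈ S, p ∈ N.places →
    (∃! t, t ∈ S ∧ N.F t p) ∧ (∃! t, t ∈ S ∧ N.F p t)

/-- `S` spans a CP-subnet of `N`: nonempty, weakly connected, transition-bordered,
a T-net, and the complement contains a transition and is strongly connected. -/
def IsCPSubnet (N : Net α) (S : Finset α) : Prop :=
  S.Nonempty ∧ S ⊆ N.nodes ∧ N.WeaklyConnectedOn S ∧ N.TransitionBordered S ∧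
  N.TNetOn S ∧ ((N.nodes \ S) ∩ N.transitions).Nonempty ∧
  N.StronglyConnectedOn (N.nodes \ S)

/-- The full subnet of `N` spanned by the node set `S`, as a net. -/
def restrict (N : Net α) (S : Finset α) : Net α where
  places := N.places ∩ S
  transitions := N.transitions ∩ S
  F := fun x y => x ∈ S ∧ y ∈ S ∧ N.F x y
  disj := N.disj.mono Finset.inter_subset_left Finset.inter_subset_left
  edges := by
    rintro x y ⟨hx, hy, hF⟩
    rcases N.edges x y hF with ⟨h1, h2⟩ | ⟨h1, h2⟩
    · exact Or.inl ⟨Finset.mem_inter.mpr ⟨h1, hx⟩, Finset.mem_inter.mpr ⟨h2, hy⟩⟩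
    · exact Or.inr ⟨Finset.mem_inter.mpr ⟨h1, hx⟩, Finset.mem_inter.mpr ⟨h2, hy⟩⟩

/-- A CP-exhaustion: a family of pairwise disjoint CP-subnets whose complement
is a strongly connected T-net. -/
def IsCPExhaustion (N : Net α) {n : ℕ}
    (Nhat : Fin n → Finset α) : Prop :=
  (∀ i, N.IsCPSubnet (Nhat i)) ∧
  (∀ i j, i ≠ j → Disjoint (Nhat i) (Nhat j)) ∧
  N.StronglyConnectedOn (N.nodes \ Finset.univ.biUnion Nhat) ∧
  N.TNetOn (N.nodes \ Finset.univ.biUnion Nhat)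

/-- `t` is a way-in transition of the subnet spanned by `S`: a transition of `S`
with a pre-place outside `S`. -/
def IsWayIn (N : Net α) (S : Finset α) (t : α) : Prop :=
  t ∈ S ∧ t ∈ N.transitions ∧ ∃ p ∈ N.places, p ∉ S ∧ N.F p t

/-- A shutdown sequence for the subnet spanned by `S` (with way-in transition
`tin`) at a marking `μ`: an occurrence sequence enabled at `μ` using only
transitions of `S` other than `tin`, after which no transition of `S` other
than (possibly) `tin` is enabled. -/
def IsShutdownSeq (N : Net α) (S : Finset α) (tin : α)
    (μ : α → ℕ) (σ : List α) (μsd : α → ℕ) : Prop :=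
  N.FireSeq μ σ μsd ∧
  (∀ t ∈ σ, t ∈ S ∧ t ∈ N.transitions ∧ t ≠ tin) ∧
  (∀ t ∈ S, t ∈ N.transitions → t ≠ tin → ¬ N.Enabled μsd t)

/-- `C` spans a P-component of `N`: nonempty, strongly connected, inside `C`
every transition has exactly one pre-place and one post-place, and every place
of `C` has all its neighbours inside `C`. -/
def IsPComponent (N : Net α) (C : Finset α) : Prop :=
  C.Nonempty ∧ C ⊆ N.nodes ∧ N.StronglyConnectedOn C ∧
  (∀ t ∈ C, t ∈ N.transitions →
    (∃! p, p ∈ C ∧ N.F p t) ∧ (∃! p, p ∈ C ∧ N.F t p)) ∧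
  (∀ p ∈ C, p ∈ N.places → ∀ y, (N.F y p ∨ N.F p y) → y ∈ C)

end Net

namespace Net

variable {α : Type*} {N : Net α}

lemma notMem_transitions_of_mem_places {x : α} (hx : x ∈ N.places) : x ∉ N.transitions :=
  fun h => Finset.disjoint_left.mp N.disj hx h

lemma mem_places_of_F_transition {p t : α} (h : N.F p t) (ht : t ∈ N.transitions) :
    p ∈ N.places := by
  rcases N.edges p t h with h' | h'
  · exact h'.1
  · exact absurd ht (notMem_transitions_of_mem_places h'.2)

lemma mem_transitions_of_F_place {t p : α} (h : N.F t p) (hp : p ∈ N.places) :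
    t ∈ N.transitions := by
  rcases N.edges t p h with h' | h'
  · exact absurd h'.2 (notMem_transitions_of_mem_places hp)
  · exact h'.1

lemma mem_transitions_of_place_F {p t : α} (h : N.F p t) (hp : p ∈ N.places) :
    t ∈ N.transitions := by
  rcases N.edges p t h with h' | h'
  · exact h'.2
  · exact absurd h'.1 (notMem_transitions_of_mem_places hp)

lemma mem_places_of_transition_F {t p : α} (h : N.F t p) (ht : t ∈ N.transitions) :
    p ∈ N.places := by
  rcases N.edges t p h with h' | h'
  · exact absurd ht (notMem_transitions_of_mem_places h'.1)
  · exact h'.2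

lemma FireSeq.append {m m' m'' : α → ℕ} {σ τ : List α} (h : N.FireSeq m σ m')
    (h' : N.FireSeq m' τ m'') : N.FireSeq m (σ ++ τ) m'' := by
  induction h with
  | nil => exact h'
  | cons ht _ ih => exact .cons ht (ih h')

lemma FireSeq.single {m : α → ℕ} {t : α} (ht : N.Enabled m t) :
    N.FireSeq m [t] (N.fire t m) := .cons ht (.nil _)

lemma Reach.trans {m m' m'' : α → ℕ} (h : N.Reach m m') (h' : N.Reach m' m'') :
    N.Reach m m'' := by
  obtain ⟨σ, hσ⟩ := h
  obtain ⟨τ, hτ⟩ := h'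
  exact ⟨_, hσ.append hτ⟩

lemma Reach.fire {m m' : α → ℕ} {t : α} (h : N.Reach m m') (ht : N.Enabled m' t) :
    N.Reach m (N.fire t m') := h.trans ⟨_, .single ht⟩

/-- A place whose input transition needs no token can be filled without bound. -/
lemma Bounded.exists_F_of_F {μ m : α → ℕ} (hb : N.Bounded μ) (hm : N.Reach μ m) {t p : α}
    (ht : t ∈ N.transitions) (htp : N.F t p) : ∃ q, N.F q t := by
  by_contra! hsrc
  obtain ⟨K, hK⟩ := hb
  have key : ∀ n : ℕ, ∃ m', N.Reach μ m' ∧ n ≤ m' p := by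
    intro n
    induction n with
    | zero => exact ⟨m, hm, Nat.zero_le _⟩
    | succ n ih =>
      obtain ⟨m', hr, hn⟩ := ih
      refine ⟨_, hr.fire (t := t) ⟨ht, fun q hq => absurd hq (hsrc q)⟩, ?_⟩
      simp only [fire, hsrc p, htp, if_true, if_false]
      omega
  obtain ⟨m', hr, hn⟩ := key (K + 1)
  have := hK m' hr p (mem_places_of_transition_F htp ht)
  omega

/-- In a T-net, a set of nodes closed under successors may be frozen: dropping its transitions
from an occurrence sequence yields an occurrence sequence. -/
lemma FireSeq.filter_notMem (hT : N.IsTNet) {D : Set α}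
    (hD : ∀ x ∈ D, ∀ y, N.F x y → y ∈ D) {m m' : α → ℕ} {σ : List α}
    (h : N.FireSeq m σ m') (n : α → ℕ)
    (hn : ∀ q ∈ N.places, (∀ t, N.F q t → t ∉ D) → m q ≤ n q) :
    ∃ n', N.FireSeq n (σ.filter (fun t => decide (t ∉ D))) n' := by
  induction h generalizing n with
  | nil => exact ⟨n, .nil n⟩
  | @cons μ ν t σ ht _ ih =>
    by_cases htD : t ∈ D
    · obtain ⟨n', hn'⟩ := ih n fun q hq hqD => by
        have hnF : ¬ N.F t q := fun hF => by
          obtain ⟨s, hs, -⟩ := (hT q hq).2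
          exact hqD s hs (hD q (hD t htD q hF) s hs)
        have := hn q hq hqD
        simp only [fire, hnF, if_false]
        omega
      exact ⟨n', by simpa [htD] using hn'⟩
    · have hen : N.Enabled n t := by
        refine ⟨ht.1, fun q hq => (ht.2 q hq).trans ?_⟩
        have hqp := mem_places_of_F_transition hq ht.1
        refine hn q hqp fun s hs => ?_
        rwa [(hT q hqp).2.unique hs hq]
      obtain ⟨n', hn'⟩ := ih (N.fire t n) fun q hq hqD => by
        have := hn q hq hqD
        simp only [fire]
        omega
      exact ⟨n', by simpa [htD] using FireSeq.cons hen hn'⟩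

lemma IsCluster.F_of_mem [DecidableEq α] (hT : N.IsTNet) {cl : Set α}
    (hcl : N.IsCluster cl) {t p : α}
    (ht : t ∈ cl) (htt : t ∈ N.transitions) (hp : p ∈ cl) (hpp : p ∈ N.places) :
    N.F p t := by
  obtain ⟨x, hx, rfl⟩ := hcl
  obtain ⟨s, hs, hxs⟩ : ∃ s ∈ N.transitions, x = s ∨ N.F x s := by
    rcases Finset.mem_union.mp hx with h | h
    · obtain ⟨s, hs, -⟩ := (hT x h).2
      exact ⟨s, mem_transitions_of_place_F hs h, Or.inr hs⟩
    · exact ⟨x, h, Or.inl rfl⟩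
  have hsub : N.clusterOf x ⊆ {y | y = s ∨ N.F y s} := by
    refine Set.sInter_subset_of_mem ⟨hxs, ?_, ?_⟩
    · rintro q (rfl | hq) hqp r hr
      · exact absurd hs (notMem_transitions_of_mem_places hqp)
      · exact Or.inl ((hT q hqp).2.unique hr hq)
    · rintro r (rfl | hr) hrt q hq
      · exact Or.inr hq
      · exact absurd hrt
          (notMem_transitions_of_mem_places (mem_places_of_F_transition hr hs))
  have h1 : t = s := (hsub ht).resolve_right fun h =>
    notMem_transitions_of_mem_places (mem_places_of_F_transition h hs) htt
  have h2 : N.F p s := (hsub hp).resolve_left fun h =>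
    notMem_transitions_of_mem_places hpp (h ▸ hs)
  exact h1 ▸ h2

/-- If `M` marks only places whose output transition is `t`, then in a live and bounded T-system
through `M` every transition with an output place is a descendant of `t`. -/
lemma reflTransGen_of_F_place (hT : N.IsTNet) {μ M : α → ℕ} (hl : N.Live μ)
    (hb : N.Bounded μ) (hM : N.Reach μ M) {t : α}
    (hMt : ∀ q ∈ N.places, M q ≠ 0 → N.F q t) {u p : α} (hu : u ∈ N.transitions)
    (hup : N.F u p) : Relation.ReflTransGen N.F t u := by
  by_contra htu
  set B : Set α := {x | Relation.ReflTransGen N.F x u}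
  have hBpre : ∀ x y, N.F x y → y ∈ B → x ∈ B := fun x y h hy =>
    Relation.ReflTransGen.head h hy
  have hdead : ∀ m, N.Reach μ m → (∀ q ∈ N.places, q ∈ B → m q = 0) →
      ∀ s ∈ B, ¬ N.Enabled m s := by
    intro m hm hzero s hs hen
    obtain ⟨y, hy⟩ : ∃ y, N.F s y := by
      rcases Relation.ReflTransGen.cases_head hs with rfl | ⟨y, hy, -⟩
      · exact ⟨p, hup⟩
      · exact ⟨y, hy⟩
    obtain ⟨q, hq⟩ := hb.exists_F_of_F hm hen.1 hy
    have h1 := hen.2 q hq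
    have h2 := hzero q (mem_places_of_F_transition hq hen.1) (hBpre q s hq hs)
    omega
  have hinv : ∀ m σ m', N.FireSeq m σ m' → N.Reach μ m →
      (∀ q ∈ N.places, q ∈ B → m q = 0) → ∀ q ∈ N.places, q ∈ B → m' q = 0 := by
    intro m σ m' h
    induction h with
    | nil => exact fun _ h => h
    | @cons m ν s σ hs _ ih =>
      intro hm hzero
      refine ih (hm.fire hs) fun q hq hqB => ?_
      have hnF : ¬ N.F s q := fun hF => hdead m hm hzero s (hBpre s q hF hqB) hs
      simp [fire, hnF, hzero q hq hqB]
  have hM0 : ∀ q ∈ N.places, q ∈ B → M q = 0 := by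
    intro q hq hqB
    by_contra hne
    rcases Relation.ReflTransGen.cases_head hqB with rfl | ⟨y, hy, hyu⟩
    · exact notMem_transitions_of_mem_places hq hu
    · exact htu ((hT q hq).2.unique hy (hMt q hq hne) ▸ hyu)
  obtain ⟨ν, ⟨σ, hσ⟩, hen⟩ := hl u hu M hM
  exact hdead ν (hM.trans ⟨σ, hσ⟩) (hinv M σ ν hσ hM hM0) u .refl hen

variable [DecidableEq α]

/-- The marking equation of a T-net, one place at a time. -/
lemma FireSeq.add_count_eq (hT : N.IsTNet) {m m' : α → ℕ} {σ : List α}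
    (h : N.FireSeq m σ m') {p a b : α} (hp : p ∈ N.places) (ha : N.F a p) (hb : N.F p b) :
    m' p + σ.count b = m p + σ.count a := by
  have hina : ∀ t, N.F t p ↔ a = t := fun t =>
    ⟨fun ht => (hT p hp).1.unique ha ht, fun ht => ht ▸ ha⟩
  have houtb : ∀ t, N.F p t ↔ b = t := fun t =>
    ⟨fun ht => (hT p hp).2.unique hb ht, fun ht => ht ▸ hb⟩
  induction h with
  | nil => simp
  | @cons μ ν t σ ht _ ih =>
    have hpos : N.F p t → 1 ≤ μ p := ht.2 p
    simp only [fire, hina, houtb] at ih hpos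
    simp only [List.count_cons, beq_iff_eq, eq_comm (a := t)]
    split_ifs at ih ⊢ with h1 h2 <;> simp_all <;> omega

lemma Live.exists_count_ge {μ : α → ℕ} (hl : N.Live μ) {t : α} (ht : t ∈ N.transitions)
    (k : ℕ) : ∃ σ m, N.FireSeq μ σ m ∧ k ≤ σ.count t := by
  induction k with
  | zero => exact ⟨[], μ, .nil μ, Nat.zero_le _⟩
  | succ k ih =>
    obtain ⟨σ, m, hσ, hk⟩ := ih
    obtain ⟨ν, ⟨τ, hτ⟩, hen⟩ := hl t ht m ⟨σ, hσ⟩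
    refine ⟨_, _, (hσ.append hτ).append (.single hen), ?_⟩
    simp only [List.count_append, List.count_singleton_self]
    omega

/-- In a live and bounded T-system, descendance between transitions is symmetric. -/
lemma reflTransGen_symm_of_transition (hT : N.IsTNet) {μ : α → ℕ} (hl : N.Live μ)
    (hb : N.Bounded μ) {t v : α} (hv : v ∈ N.transitions)
    (htv : Relation.ReflTransGen N.F t v) : Relation.ReflTransGen N.F v t := by
  by_contra hvt
  set D : Set α := {x | Relation.ReflTransGen N.F v x}
  have hD : ∀ x ∈ D, ∀ y, N.F x y → y ∈ D := fun x hx y h => Relation.ReflTransGen.tail hx h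
  obtain ⟨q, y, hqy, hqD, hyD⟩ : ∃ q y, N.F q y ∧ q ∉ D ∧ y ∈ D := by
    by_contra! hno
    have : ∀ x, Relation.ReflTransGen N.F t x → x ∉ D := by
      intro x hx
      induction hx with
      | refl => exact hvt
      | tail _ h ih => exact hno _ _ h ih
    exact this v htv .refl
  have hq : q ∈ N.places := by
    rcases N.edges q y hqy with h | h
    · exact h.1
    · rcases Relation.ReflTransGen.cases_tail hyD with rfl | ⟨z, hz, hzy⟩
      · exact absurd hv (notMem_transitions_of_mem_places h.2)
      · exact absurd ((hT y h.2).1.unique hzy hqy ▸ hz) hqD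
  obtain ⟨w, hw, -⟩ := (hT q hq).1
  have hwD : w ∉ D := fun h => hqD (hD w h q hw)
  obtain ⟨K, hK⟩ := hb
  obtain ⟨σ, m, hσ, hk⟩ := hl.exists_count_ge (mem_transitions_of_F_place hw hq) (K + 1)
  obtain ⟨n, hn⟩ := hσ.filter_notMem hT hD μ fun _ _ _ => le_rfl
  have heq := hn.add_count_eq hT hq hw hqy
  have hcw : (σ.filter (fun t => decide (t ∉ D))).count w = σ.count w :=
    List.count_filter (by simpa using hwD)
  have hcy : (σ.filter (fun t => decide (t ∉ D))).count y = 0 :=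
    List.count_eq_zero.mpr (by simp [hyD])
  have := hK n ⟨_, hn⟩ q hq
  omega

/-- The number of tokens on a list of nodes, counted with multiplicity. -/
def listCount (N : Net α) (m : α → ℕ) (L : List α) : ℕ :=
  (L.map fun x => if x ∈ N.places then m x else 0).sum

@[simp] lemma listCount_cons (m : α → ℕ) (x : α) (L : List α) :
    N.listCount m (x :: L) = (if x ∈ N.places then m x else 0) + N.listCount m L := by
  simp [listCount]

@[simp] lemma listCount_nil (m : α → ℕ) : N.listCount m [] = 0 := rfl

@[simp] lemma listCount_append (m : α → ℕ) (L L' : List α) :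
    N.listCount m (L ++ L') = N.listCount m L + N.listCount m L' := by
  simp [listCount]

lemma tokenCount_toFinset (m : α → ℕ) {L : List α} (hL : L.Nodup) :
    N.tokenCount m L.toFinset = N.listCount m L := by
  rw [tokenCount, listCount, ← List.sum_toFinset _ hL, Finset.sum_ite_mem]

/-- Firing preserves the token count of a closed walk of a T-net. -/
lemma FireSeq.listCount_eq (hT : N.IsTNet) {m m' : α → ℕ} {σ : List α}
    (h : N.FireSeq m σ m') {t : α} (ht : t ∈ N.transitions) {L : List α}
    (hL : (t :: (L ++ [t])).IsChain N.F) : N.listCount m' L = N.listCount m L := by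
  have htp : t ∉ N.places := fun h => notMem_transitions_of_mem_places h ht
  obtain ⟨inflow, hin⟩ : ∃ f : α → ℕ, ∀ x, (x ∉ N.places → f x = σ.count x) ∧
      (∀ a, x ∈ N.places → N.F a x → f x = σ.count a) := by
    choose f hf using fun x => show ∃ k : ℕ, (x ∉ N.places → k = σ.count x) ∧
        (∀ a, x ∈ N.places → N.F a x → k = σ.count a) by
      by_cases hx : x ∈ N.places
      · obtain ⟨a, ha, hua⟩ := (hT x hx).1
        exact ⟨σ.count a, fun h => absurd hx h, fun b _ hb => by rw [hua b hb]⟩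
      · exact ⟨σ.count x, fun _ => rfl, fun _ h => absurd h hx⟩
    exact ⟨f, hf⟩
  have hstep : ∀ x y, N.F x y → (if x ∈ N.places then m' x else 0) + inflow y =
      (if x ∈ N.places then m x else 0) + inflow x := by
    intro x y hxy
    by_cases hx : x ∈ N.places
    · obtain ⟨a, ha, -⟩ := (hT x hx).1
      have hy : y ∉ N.places := fun h =>
        notMem_transitions_of_mem_places h (mem_transitions_of_place_F hxy hx)
      rw [if_pos hx, if_pos hx, (hin y).1 hy, (hin x).2 a hx ha]
      exact h.add_count_eq hT hx ha hxy
    · have hy : y ∈ N.places := by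
        rcases N.edges x y hxy with h | h
        · exact absurd h.1 hx
        · exact h.2
      rw [if_neg hx, if_neg hx, (hin y).2 x hy hxy, (hin x).1 hx]
  have hwalk : ∀ (L : List α) (x : α), (x :: (L ++ [t])).IsChain N.F →
      N.listCount m' (x :: L) + inflow t = N.listCount m (x :: L) + inflow x := by
    intro L
    induction L with
    | nil =>
      intro x hx
      have := hstep x t (by simpa using hx)
      simpa using this
    | cons y L ih =>
      intro x hx
      rw [List.cons_append, List.isChain_cons_cons] at hx
      have h1 := hstep x y hx.1
      have h2 := ih y hx.2
      rw [listCount_cons, listCount_cons (L := y :: L)]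
      omega
  have := hwalk L t hL
  simpa [htp] using this

/-- A walk avoiding `t` carries at most one token of a marking that puts at most one token on
each input place of `t` and none elsewhere. -/
lemma listCount_le_one (hT : N.IsTNet) {M : α → ℕ} {t : α}
    (hMt : ∀ q ∈ N.places, M q ≠ 0 → N.F q t) (hM1 : ∀ q ∈ N.places, M q ≤ 1)
    {L : List α} (hL : L.IsChain N.F) (ht : t ∉ L) : N.listCount M L ≤ 1 := by
  induction L with
  | nil => simp
  | cons x L ih =>
    cases L with
    | nil =>
      simp only [listCount_cons, listCount_nil]
      split_ifs with hx
      · exact hM1 x hx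
      · omega
    | cons y L =>
      rw [List.isChain_cons_cons] at hL
      rw [listCount_cons]
      have hx0 : (if x ∈ N.places then M x else 0) = 0 := by
        split_ifs with hx
        · by_contra hne
          exact ht (by simp [(hT x hx).2.unique (hMt x hx hne) hL.1])
        · rfl
      rw [hx0, zero_add]
      exact ih hL.2 fun h => ht (List.mem_cons_of_mem _ h)

end Net

lemma Relation.ReflTransGen.exists_isChain_from_avoiding {α : Type*} {r : α → α → Prop}
    {t x : α} (h : Relation.ReflTransGen r t x) (hx : x ≠ t) :
    ∃ L : List α, t ∉ L ∧ (t :: (L ++ [x])).IsChain r := by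
  induction h with
  | refl => exact absurd rfl hx
  | @tail y x _ hyx ih =>
    by_cases hy : y = t
    · subst hy
      exact ⟨[], by simp, by simpa using hyx⟩
    · obtain ⟨L, hL, hc⟩ := ih hy
      refine ⟨L ++ [y], by simp [hL, Ne.symm hy], ?_⟩
      have : (t :: L ++ y :: [x]).IsChain r :=
        List.isChain_split.mpr ⟨hc, by simpa using hyx⟩
      simpa using this

lemma Relation.ReflTransGen.exists_isChain_to_avoiding {α : Type*} {r : α → α → Prop}
    {t x : α} (h : Relation.ReflTransGen r x t) (hx : x ≠ t) :
    ∃ L : List α, t ∉ L ∧ (x :: (L ++ [t])).IsChain r := by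
  induction h using Relation.ReflTransGen.head_induction_on with
  | refl => exact absurd rfl hx
  | @head x y hxy _ ih =>
    by_cases hy : y = t
    · subst hy
      exact ⟨[], by simp, by simpa using hxy⟩
    · obtain ⟨L, hL, hc⟩ := ih hy
      exact ⟨y :: L, by simp [hL, Ne.symm hy], by simpa using ⟨hxy, hc⟩⟩

/-- **Safety of paths avoiding the regeneration transition.** In a perpetual
T-system `(TN, μ)` with regeneration cluster `cl` and unique transition
`t_cl ∈ cl`, every elementary path `δ` not containing `t_cl` has token count
`‖μ‖_δ ≤ 1`. -/
theorem perpetual_tSystem_path_avoiding_tcl_safe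
    {α : Type*} [DecidableEq α] (TN : Net α) (μ : α → ℕ)
    (hT : TN.IsTNet) (cl : Set α) (hperp : TN.Perpetual μ cl)
    (tcl : α) (htcl : tcl ∈ cl ∧ tcl ∈ TN.transitions)
    (δ : List α) (hδ : TN.IsPath δ) (helem : δ.Nodup) (havoid : tcl ∉ δ) :
    TN.tokenCount μ δ.toFinset ≤ 1 := by
  obtain ⟨hl, hb, hcl, hhome⟩ := hperp
  obtain ⟨htc, htt⟩ := htcl
  obtain ⟨-, -, hchain : δ.IsChain TN.F⟩ := hδ
  rw [Net.tokenCount_toFinset μ helem]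
  obtain ⟨M, ⟨σ, hσ⟩, hM⟩ := hhome μ ⟨[], .nil μ⟩
  have hMt : ∀ q ∈ TN.places, M q ≠ 0 → TN.F q tcl := by
    intro q hq hne
    rw [hM q hq, Net.clusterMarking] at hne
    exact hcl.F_of_mem hT htc htt (by by_contra h; simp [h] at hne) hq
  have hM1 : ∀ q ∈ TN.places, M q ≤ 1 := by
    intro q hq
    rw [hM q hq, Net.clusterMarking]
    split_ifs <;> omega
  have hfrom : ∀ x y, TN.F x y → Relation.ReflTransGen TN.F tcl x := by
    intro x y hxy
    rcases TN.edges x y hxy with h | h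
    · obtain ⟨u, hu, -⟩ := (hT x h.1).1
      exact (Net.reflTransGen_of_F_place hT hl hb ⟨σ, hσ⟩ hMt
        (Net.mem_transitions_of_F_place hu h.1) hu).tail hu
    · exact Net.reflTransGen_of_F_place hT hl hb ⟨σ, hσ⟩ hMt h.1 hxy
  have hto : ∀ x y, TN.F x y → Relation.ReflTransGen TN.F y tcl := by
    intro x y hxy
    rcases TN.edges x y hxy with h | h
    · exact Net.reflTransGen_symm_of_transition hT hl hb h.2 ((hfrom x y hxy).tail hxy)
    · obtain ⟨v, hv, -⟩ := (hT y h.2).2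
      exact (Net.reflTransGen_symm_of_transition hT hl hb
        (Net.mem_transitions_of_place_F hv h.2) (((hfrom x y hxy).tail hxy).tail hv)).head hv
  have main : ∀ d e D E, δ = d :: D → δ = E ++ [e] →
      Relation.ReflTransGen TN.F tcl d → Relation.ReflTransGen TN.F e tcl →
      TN.listCount μ δ ≤ 1 := by
    intro d e D E hd he hfd hte
    obtain ⟨A, hA, hAc⟩ := hfd.exists_isChain_from_avoiding
      (by rintro rfl; exact havoid (by simp [hd]))
    obtain ⟨B, hB, hBc⟩ := hte.exists_isChain_to_avoiding
      (by rintro rfl; exact havoid (by simp [he]))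
    have h1 : ((tcl :: A) ++ δ).IsChain TN.F := by
      rw [hd] at hchain ⊢
      exact List.isChain_split.mpr ⟨hAc, hchain⟩
    have h2 : ((tcl :: A ++ E) ++ e :: (B ++ [tcl])).IsChain TN.F :=
      List.isChain_split.mpr ⟨by simpa [he] using h1, hBc⟩
    have h3 : (tcl :: ((A ++ δ ++ B) ++ [tcl])).IsChain TN.F := by simpa [he] using h2
    have h4 := hσ.listCount_eq hT htt h3
    have h5 : TN.listCount M (A ++ δ ++ B) ≤ 1 :=
      Net.listCount_le_one hT hMt hM1 h3.tail.left_of_append (by simp [hA, hB, havoid])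
    simp only [Net.listCount_append] at h4 h5
    omega
  match δ, hchain, main with
  | [], _, _ => simp
  | [x], _, main =>
    by_cases hx : x ∈ TN.places
    · obtain ⟨u, hu, -⟩ := (hT x hx).1
      obtain ⟨v, hv, -⟩ := (hT x hx).2
      exact main x x [] [] rfl rfl (hfrom x v hv) (hto u x hu)
    · simp [hx]
  | x :: y :: L, hchain, main =>
    rw [List.isChain_cons_cons] at hchain
    obtain ⟨E, e, hE⟩ : ∃ E e, y :: L = E ++ [e] :=
      ⟨_, _, (List.dropLast_append_getLast (List.cons_ne_nil y L)).symm⟩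
    obtain ⟨z, hz⟩ : ∃ z, TN.F z e := by
      have hc : (x :: (E ++ [e])).IsChain TN.F := by
        rw [← hE]
        exact List.isChain_cons_cons.mpr hchain
      rcases List.eq_nil_or_concat E with rfl | ⟨E', z, rfl⟩
      · exact ⟨x, by simpa using hc⟩
      · exact ⟨z, by
          have : ((x :: E') ++ z :: [e]).IsChain TN.F := by simpa using hc
          simpa using (List.isChain_split.mp this).2⟩
    exact main x e (y :: L) (x :: E) rfl (by rw [hE]; rfl) (hfrom x y hchain.1) (hto z e hz)
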